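/- Let d be a quadratic Lie algebra, p a parabolic-type decomposition p = z + m̄ + n where m̄ = m₁ ⊕ m₂ with an isomorphism θ : m₁ → m₂, and let m̄^θ = {x + θ(x) : x ∈ m₁}. If a subspace l satisfies m̄^θ + n ⊆ l ⊆ (m̄^θ ⊕ z) + n and y ∈ m̄⁻ = {x − θ(x) : x ∈ m₁} normalizes l, then ad_y(m̄^θ) ⊆ m̄⁻ ∩ (m̄^θ + m̄⁻) forces [y, m̄^θ] = 0; consequently if m₁ is semisimple with trivial center then y = 0. -/

import Mathlib

/-- Delorme's normalizer computation, key step. Inside an ambient Lie algebra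
`d`, let `m₁, m₂` be commuting embedded Lie subalgebras, `θ : m₁ ≃ m₂` a Lie algebra
isomorphism, `Θ = m̄^θ` the graph, `M⁻ = m̄⁻` the anti-graph, and `z, n` subspaces with
`M⁻ ∩ (Θ ⊕ z + n) = 0`. If a subspace `l` satisfies `m̄^θ + n ⊆ l ⊆ (m̄^θ ⊕ z) + n` and
`y = x - θ(x) ∈ m̄⁻` normalizes `l`, then `[y, m̄^θ] = 0`, i.e. `[x, m₁] = 0`; consequently
if `m₁` is semisimple with trivial center then `y = 0`. -/
theorem delorme_antigraph_normalizer_step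
    {K : Type*} [Field K] {d : Type*} [LieRing d] [LieAlgebra K d]
    {m₁ : Type*} [LieRing m₁] [LieAlgebra K m₁]
    {m₂ : Type*} [LieRing m₂] [LieAlgebra K m₂]
    (ι₁ : m₁ →ₗ⁅K⁆ d) (ι₂ : m₂ →ₗ⁅K⁆ d)
    (hinj₁ : Function.Injective ι₁)
    (hranges : Disjoint (LinearMap.range (ι₁ : m₁ →ₗ[K] d))
      (LinearMap.range (ι₂ : m₂ →ₗ[K] d)))
    (hcomm : ∀ (a : m₁) (b : m₂), ⁅ι₁ a, ι₂ b⁆ = (0 : d))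
    (θ : m₁ ≃ₗ⁅K⁆ m₂)
    (z n : Submodule K d)
    -- the graph `m̄^θ` and the anti-graph `m̄⁻`
    (Θ Mminus : Submodule K d)
    (hΘ : Θ = LinearMap.range ((ι₁ : m₁ →ₗ[K] d) + (ι₂ : m₂ →ₗ[K] d) ∘ₗ (θ : m₁ →ₗ[K] m₂)))
    (hM : Mminus =
      LinearMap.range ((ι₁ : m₁ →ₗ[K] d) - (ι₂ : m₂ →ₗ[K] d) ∘ₗ (θ : m₁ →ₗ[K] m₂)))
    (hindep : Disjoint Mminus (Θ ⊔ z ⊔ n))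
    (l : Submodule K d)
    (hl₁ : Θ ⊔ n ≤ l) (hl₂ : l ≤ Θ ⊔ z ⊔ n)
    (x : m₁)
    (hnorm : ∀ v ∈ l, ⁅ι₁ x - ι₂ (θ x), v⁆ ∈ l) :
    (∀ w : m₁, ⁅x, w⁆ = 0) ∧
      ((∀ a : m₁, (∀ b : m₁, ⁅a, b⁆ = 0) → a = 0) → ι₁ x - ι₂ (θ x) = 0) := by
  have key : ∀ w : m₁, ⁅x, w⁆ = 0 := by
    intro w
    have hcomm' : ∀ (a : m₁) (b : m₂), ⁅ι₂ b, ι₁ a⁆ = (0 : d) := by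
      intro a b
      rw [← lie_skew, hcomm, neg_zero]
    have hb : ⁅ι₁ x - ι₂ (θ x), ι₁ w + ι₂ (θ w)⁆ = ι₁ ⁅x, w⁆ - ι₂ (θ ⁅x, w⁆) := by
      rw [sub_lie, lie_add, lie_add, hcomm, hcomm', LieHom.map_lie, LieEquiv.map_lie,
        LieHom.map_lie, add_zero, zero_add]
    have hΘw : ι₁ w + ι₂ (θ w) ∈ l := by
      apply hl₁
      apply Submodule.mem_sup_left
      rw [hΘ]
      exact ⟨w, rfl⟩
    have h1 := hl₂ (hnorm _ hΘw)
    rw [hb] at h1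
    have h2 : ι₁ ⁅x, w⁆ - ι₂ (θ ⁅x, w⁆) ∈ Mminus := by
      rw [hM]
      exact ⟨⁅x, w⁆, rfl⟩
    have h3 := sub_eq_zero.mp (Submodule.disjoint_def.mp hindep _ h2 h1)
    have h4 : ι₁ ⁅x, w⁆ = 0 :=
      Submodule.disjoint_def.mp hranges _ ⟨⁅x, w⁆, rfl⟩ ⟨θ ⁅x, w⁆, h3.symm⟩
    exact hinj₁ (by rw [h4, map_zero])
  refine ⟨key, fun h => ?_⟩
  rw [h x key]
  simp
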